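/- arXiv:math/0009103 — 2 statements merged into one kernel-verified Lean document; each statement's English description precedes it below -/
import Mathlib

section
/- Let R be a ring and E a left R-module containing a submodule S′ such that both S′ and the quotient E/S′ are simple R-modules and S′ is not isomorphic to E/S′. Then every nilpotent R-module endomorphism of E is zero. -/
/-- A nilpotent endomorphism of a simple module is zero. -/
theorem IsSimpleModule.eq_zero_of_isNilpotent {R M : Type*} [Ring R] [AddCommGroup M] [Module R M]
    [IsSimpleModule R M] {f : M →ₗ[R] M} (hf : IsNilpotent f) : f = 0 := by
  classical
  let _ : DivisionRing (Module.End R M) := Module.End.instDivisionRing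
  exact IsNilpotent.eq_zero (R := Module.End R M) hf

/-- A linear map between non-isomorphic simple modules is zero. -/
theorem IsSimpleModule.linearMap_eq_zero_of_not_equiv {R M N : Type*} [Ring R]
    [AddCommGroup M] [Module R M] [AddCommGroup N] [Module R N]
    [IsSimpleModule R M] [IsSimpleModule R N] (h : ¬ Nonempty (M ≃ₗ[R] N)) (f : M →ₗ[R] N) :
    f = 0 :=
  f.bijective_or_eq_zero.resolve_left fun hf => h ⟨LinearEquiv.ofBijective f hf⟩

/-- Used in the proof of Proposition 5 of the paper: if `E` is an `R`-module with a submodule `S'`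
such that `S'` and `E/S'` are simple and non-isomorphic, then every nilpotent `R`-module
endomorphism of `E` is zero. -/
theorem nilpotent_endo_of_extension_eq_zero
    (R : Type) [Ring R] (E : Type) [AddCommGroup E] [Module R E]
    (S' : Submodule R E)
    (h1 : IsSimpleModule R S')
    (h2 : IsSimpleModule R (E ⧸ S'))
    (h3 : ¬ Nonempty (S' ≃ₗ[R] E ⧸ S'))
    (Y : E →ₗ[R] E) (hY : IsNilpotent Y) :
    Y = 0 := by
  have hmaps : ∀ x ∈ S', Y x ∈ S' := fun x hx => by
    have := DFunLike.congr_fun (IsSimpleModule.linearMap_eq_zero_of_not_equiv h3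
      (S'.mkQ ∘ₗ Y ∘ₗ S'.subtype)) ⟨x, hx⟩
    simpa using this
  have hker : S' ≤ LinearMap.ker Y := fun x hx => by
    have := DFunLike.congr_fun (IsSimpleModule.eq_zero_of_isNilpotent
      (Module.End.isNilpotent.restrict hmaps hY)) (⟨x, hx⟩ : S')
    simpa [Subtype.ext_iff] using this
  have hrange : ∀ x, Y x ∈ S' := fun x => by
    have := DFunLike.congr_fun (IsSimpleModule.eq_zero_of_isNilpotent
      (Module.End.IsNilpotent.mapQ hmaps hY)) (S'.mkQ x)
    simpa using this
  have hzero := IsSimpleModule.linearMap_eq_zero_of_not_equiv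
    (fun ⟨e⟩ => h3 ⟨e.symm⟩) (S'.liftQ (Y.codRestrict S' hrange) (by simpa using hker))
  ext x
  have := DFunLike.congr_fun hzero (S'.mkQ x)
  simpa [Subtype.ext_iff] using this
end

section
/- Let A be a ring, B a subring of A, and (x_i)_{i∈I} a family of elements of A that is a basis of A as a right B-module. Let (M_s)_{s∈S} be a family of left A-modules, and for each s let N_s be an additive subgroup of M_s closed under the action of B such that the map ⊕_{i∈I} N_s → M_s, (n_i) ↦ Σ x_i·n_i, is bijective. If ⋂_{s∈S} Ann_B(N_s) = 0, then ⋂_{s∈S} Ann_A(M_s) = 0. -/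
/-- Ring-theoretic content of Corollary 7.2 of the paper.  Let `B` be a subring of a ring `A` and
`(x i)` a basis of `A` as a right `B`-module.  Let `(M s)` be a family of left `A`-modules, each
containing a `B`-stable additive subgroup `N s` such that `(n i) ↦ Σ (x i) • (n i)` is a
bijection `⊕ᵢ (N s) → M s`.  If the intersection of the annihilators in `B` of the `N s` is
zero, then the intersection of the annihilators in `A` of the `M s` is zero. -/
theorem annihilator_intersection_trivial
    (A : Type) [Ring A] (B : Subring A) (I : Type) (x : I → A)
    (hbasis : Function.Bijective fun c : I →₀ B => c.sum fun i b => x i * (b : A))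
    (S : Type) (M : S → Type) [∀ s, AddCommGroup (M s)] [∀ s, Module A (M s)]
    (N : ∀ s, AddSubgroup (M s))
    (hN : ∀ s, ∀ (b : B), ∀ m ∈ N s, (b : A) • m ∈ N s)
    (hbij : ∀ s, Function.Bijective fun c : I →₀ (N s) => c.sum fun i n => x i • (n : M s))
    (hB : ∀ b : B, (∀ s, ∀ m ∈ N s, (b : A) • m = 0) → b = 0) :
    ∀ a : A, (∀ s, ∀ m : M s, a • m = 0) → a = 0 := by
  intro a ha
  obtain ⟨c, rfl⟩ := hbasis.2 a
  have hc : c = 0 := by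
    ext1 i
    refine hB (c i) fun s m hm => ?_
    let d : I →₀ N s := c.mapRange (fun b : B => ⟨(b : A) • m, hN s b m hm⟩) (by simp)
    have hd : d = 0 := by
      apply (hbij s).1
      have h := ha s m
      simp only [Finsupp.sum, Finset.sum_smul, mul_smul] at h
      simp only [d, Finsupp.sum_zero_index]
      rw [Finsupp.sum_mapRange_index (by simp)]
      exact h
    exact congrArg Subtype.val (DFunLike.congr_fun hd i)
  simp [hc]
end
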